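/- arXiv:1704.01319 — 2 statements merged into one kernel-verified Lean document; each statement's English description precedes it below -/
import Mathlib

section
/- Let I be a DG Poisson ideal of R and A = R/I. Let J be the graded ideal of F(R) generated by I, ψ(I), all y_α y_β - (-1)^{|x_α||x_β|} y_β y_α - ψ({x_α, x_β}), and all y_α x_β - (-1)^{|x_α||x_β|} x_β y_α - {x_α, x_β}, and set 𝒜 = F(R)/J with the differential induced by the degree-1 graded derivation ∂ of F(R) with ∂(x_α) = d(x_α) and ∂(y_α) = ψ(d(x_α)) (which maps J into J and hence descends to 𝒜). Define m : A -> 𝒜 by m(f + I) = f + J and h : A -> 𝒜 by h(f + I) = ψ(f) + J. Then (𝒜, m, h) is a universal enveloping algebra of the DG Poisson algebra A. -/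
noncomputable section

open scoped DirectSum

/-- The sign `(-1)^m`, as an integer, for `m : ℤ`. -/
def sgn (m : ℤ) : ℤ := (Int.negOnePow m : ℤ)

/-- A differential graded Poisson algebra structure on a `ℤ`-graded `k`-algebra `A`,
whose grading is given by `𝒜`. -/
structure DGPoissonAlgebra (k : Type) [Field k] (A : Type) [Ring A] [Algebra k A]
    (𝒜 : ℤ → Submodule k A) : Type where
  /-- the Poisson bracket -/
  br : A →ₗ[k] A →ₗ[k] A
  /-- the differential -/
  d : A →ₗ[k] A
  br_mem : ∀ ⦃i j : ℤ⦄ ⦃a b : A⦄, a ∈ 𝒜 i → b ∈ 𝒜 j → br a b ∈ 𝒜 (i + j)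
  d_mem : ∀ ⦃i : ℤ⦄ ⦃a : A⦄, a ∈ 𝒜 i → d a ∈ 𝒜 (i + 1)
  antisymm : ∀ ⦃i j : ℤ⦄ ⦃a b : A⦄, a ∈ 𝒜 i → b ∈ 𝒜 j →
    br a b = -(sgn (i * j) • br b a)
  jacobi : ∀ ⦃i j l : ℤ⦄ ⦃a b c : A⦄, a ∈ 𝒜 i → b ∈ 𝒜 j → c ∈ 𝒜 l →
    br a (br b c) = br (br a b) c + sgn (i * j) • br b (br a c)
  gcomm : ∀ ⦃i j : ℤ⦄ ⦃a b : A⦄, a ∈ 𝒜 i → b ∈ 𝒜 j → a * b = sgn (i * j) • (b * a)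
  leibniz : ∀ ⦃i j l : ℤ⦄ ⦃a b c : A⦄, a ∈ 𝒜 i → b ∈ 𝒜 j → c ∈ 𝒜 l →
    br a (b * c) = br a b * c + sgn (i * j) • (b * br a c)
  d_sq : ∀ a : A, d (d a) = 0
  d_br : ∀ ⦃i j : ℤ⦄ ⦃a b : A⦄, a ∈ 𝒜 i → b ∈ 𝒜 j →
    d (br a b) = br (d a) b + sgn i • br a (d b)
  d_mul : ∀ ⦃i j : ℤ⦄ ⦃a b : A⦄, a ∈ 𝒜 i → b ∈ 𝒜 j →
    d (a * b) = d a * b + sgn i • (a * d b)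

/-- A differential graded algebra structure (i.e. a differential) on a `ℤ`-graded
`k`-algebra `B` with grading `ℬ`. -/
structure DGAlgebra (k : Type) [Field k] (B : Type) [Ring B] [Algebra k B]
    (ℬ : ℤ → Submodule k B) : Type where
  /-- the differential -/
  d : B →ₗ[k] B
  d_mem : ∀ ⦃i : ℤ⦄ ⦃b : B⦄, b ∈ ℬ i → d b ∈ ℬ (i + 1)
  d_sq : ∀ b : B, d (d b) = 0
  d_mul : ∀ ⦃i j : ℤ⦄ ⦃a b : B⦄, a ∈ ℬ i → b ∈ ℬ j →
    d (a * b) = d a * b + sgn i • (a * d b)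

/-- `f` is a DG algebra map: a degree-`0` algebra map commuting with the differentials. -/
structure IsDGAlgebraMap (k : Type) [Field k] {A B : Type} [Ring A] [Algebra k A]
    [Ring B] [Algebra k B] (𝒜 : ℤ → Submodule k A) (ℬ : ℤ → Submodule k B)
    (dA : A →ₗ[k] A) (dB : B →ₗ[k] B) (f : A →ₐ[k] B) : Prop where
  map_mem : ∀ ⦃i : ℤ⦄ ⦃a : A⦄, a ∈ 𝒜 i → f a ∈ ℬ i
  map_d : ∀ a : A, f (dA a) = dB (f a)

/-- The compatibility conditions satisfied by a pair `(f, g)` from a DG Poisson algebra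
`A` to a DG algebra `B`: `f` is a DG algebra map, `g` is a degree-`0` `k`-linear map
commuting with the differentials which is a graded Lie algebra map into `B` with the
graded commutator, and the two mixed identities hold. -/
def UEACompat (k : Type) [Field k] {A B : Type} [Ring A] [Algebra k A]
    [Ring B] [Algebra k B] (𝒜 : ℤ → Submodule k A) (ℬ : ℤ → Submodule k B)
    (P : DGPoissonAlgebra k A 𝒜) (dB : B →ₗ[k] B)
    (f : A →ₐ[k] B) (g : A →ₗ[k] B) : Prop :=
  IsDGAlgebraMap k 𝒜 ℬ P.d dB f ∧
  (∀ ⦃i : ℤ⦄ ⦃a : A⦄, a ∈ 𝒜 i → g a ∈ ℬ i) ∧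
  (∀ a : A, g (P.d a) = dB (g a)) ∧
  (∀ ⦃i j : ℤ⦄ ⦃a b : A⦄, a ∈ 𝒜 i → b ∈ 𝒜 j →
    g (P.br a b) = g a * g b - sgn (i * j) • (g b * g a)) ∧
  (∀ ⦃i j : ℤ⦄ ⦃a b : A⦄, a ∈ 𝒜 i → b ∈ 𝒜 j →
    f (P.br a b) = g a * f b - sgn (i * j) • (f b * g a)) ∧
  (∀ ⦃i j : ℤ⦄ ⦃a b : A⦄, a ∈ 𝒜 i → b ∈ 𝒜 j →
    g (a * b) = f a * g b + sgn (i * j) • (f b * g a))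

/-- `(E, α, β)` is a universal enveloping algebra of the DG Poisson algebra `A`. -/
def IsUEA (k : Type) [Field k] {A E : Type} [Ring A] [Algebra k A] [Ring E] [Algebra k E]
    (𝒜 : ℤ → Submodule k A) (ℰ : ℤ → Submodule k E)
    (P : DGPoissonAlgebra k A 𝒜) (DE : DGAlgebra k E ℰ)
    (α : A →ₐ[k] E) (β : A →ₗ[k] E) : Prop :=
  UEACompat k 𝒜 ℰ P DE.d α β ∧
  ∀ (D : Type) [Ring D] [Algebra k D] (𝒟 : ℤ → Submodule k D) [GradedAlgebra 𝒟]
    (dD : DGAlgebra k D 𝒟) (f : A →ₐ[k] D) (g : A →ₗ[k] D),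
    UEACompat k 𝒜 𝒟 P dD.d f g →
    ∃! φ : E →ₐ[k] D, IsDGAlgebraMap k ℰ 𝒟 DE.d dD.d φ ∧
      φ.comp α = f ∧ φ.toLinearMap.comp β = g

/-- The two-sided ideal of `F` generated by a set `S`, as a `k`-submodule. -/
def idealGen (k : Type) [Field k] {F : Type} [Ring F] [Algebra k F] (S : Set F) :
    Submodule k F :=
  Submodule.span k {z : F | ∃ u v : F, ∃ s ∈ S, z = u * s * v}

/-- The left ideal of `F` generated by a set `S`, as a `k`-submodule. -/
def leftIdealGen (k : Type) [Field k] {F : Type} [Ring F] [Algebra k F] (S : Set F) :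
    Submodule k F :=
  Submodule.span k {z : F | ∃ u : F, ∃ s ∈ S, z = u * s}

/-- A submodule is graded if it is spanned by its homogeneous elements. -/
def IsGradedSubmodule (k : Type) [Field k] {A : Type} [AddCommGroup A] [Module k A]
    (𝒜 : ℤ → Submodule k A) (M : Submodule k A) : Prop :=
  M ≤ Submodule.span k {a : A | a ∈ M ∧ ∃ i, a ∈ 𝒜 i}

/-- A `k`-submodule which is a two-sided ideal. -/
def IsTwoSidedIdealSub (k : Type) [Field k] {A : Type} [Ring A] [Algebra k A]
    (M : Submodule k A) : Prop :=
  ∀ r : A, ∀ m ∈ M, r * m ∈ M ∧ m * r ∈ M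

/-- A DG ideal: a graded two-sided ideal closed under the differential `d`. -/
def IsDGIdeal (k : Type) [Field k] {A : Type} [Ring A] [Algebra k A]
    (𝒜 : ℤ → Submodule k A) (d : A →ₗ[k] A) (M : Submodule k A) : Prop :=
  IsTwoSidedIdealSub k M ∧ IsGradedSubmodule k 𝒜 M ∧ ∀ m ∈ M, d m ∈ M

/-- A DG Poisson ideal: a DG ideal which is also closed under the Poisson bracket. -/
def IsDGPoissonIdeal (k : Type) [Field k] {A : Type} [Ring A] [Algebra k A]
    (𝒜 : ℤ → Submodule k A) (P : DGPoissonAlgebra k A 𝒜) (M : Submodule k A) : Prop :=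
  IsDGIdeal k 𝒜 P.d M ∧ ∀ a : A, ∀ m ∈ M, P.br a m ∈ M

/-- `π : A → B` presents `B` as the quotient of `A` by `I`. -/
structure IsQuotientBy (k : Type) [Field k] {A B : Type} [Ring A] [Algebra k A]
    [Ring B] [Algebra k B] (π : A →ₐ[k] B) (I : Submodule k A) : Prop where
  surj : Function.Surjective π
  ker : ∀ a : A, π a = 0 ↔ a ∈ I

/-- The (noncommutative, ordered) monomial `x 0 ^ e 0 * x 1 ^ e 1 * ⋯` . -/
def xMono {n : ℕ} {R : Type} [Ring R] (x : Fin n → R) (e : Fin n → ℕ) : R :=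
  ((List.finRange n).map fun r => x r ^ e r).prod
/-- The map `ψ : R → F(R)`, `ψ(f) = ∑_α ψ_α(f) y_α`. -/
def psiF {k R F : Type} [Field k] [Ring R] [Algebra k R] [Ring F] [Algebra k F]
    {Λ : Type} (ι : R →ₐ[k] F) (ψ : Λ → R →ₗ[k] R) (y : Λ → F) (f : R) : F :=
  ∑ᶠ α : Λ, ι (ψ α f) * y α

/-- The generators of the graded ideal `J` of `F(R)`: `I`, `ψ(I)`,
`y_α y_β - (-1)^{|x_α||x_β|} y_β y_α - ψ({x_α, x_β})` and
`y_α x_β - (-1)^{|x_α||x_β|} x_β y_α - {x_α, x_β}`. -/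
def Jgens {k R F : Type} [Field k] [Ring R] [Algebra k R] [Ring F] [Algebra k F]
    {Λ : Type} (𝒜 : ℤ → Submodule k R) (P : DGPoissonAlgebra k R 𝒜)
    (x : Λ → R) (w : Λ → ℤ) (ι : R →ₐ[k] F) (ψ : Λ → R →ₗ[k] R) (y : Λ → F)
    (I : Submodule k R) : Set F :=
  (⇑ι '' (I : Set R)) ∪ (psiF ι ψ y '' (I : Set R)) ∪
  {z | ∃ α β, z = y α * y β - sgn (w α * w β) • (y β * y α)
      - psiF ι ψ y (P.br (x α) (x β))} ∪
  {z | ∃ α β, z = y α * ι (x β) - sgn (w α * w β) • (ι (x β) * y α)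
      - ι (P.br (x α) (x β))}

theorem sgn_add (a b : ℤ) : sgn (a + b) = sgn a * sgn b := by
  simp [sgn, Int.negOnePow_add]

theorem sgn_zero : sgn 0 = 1 := by simp [sgn]

theorem sgn_eq_one_or (a : ℤ) : sgn a = 1 ∨ sgn a = -1 := by
  rcases Int.units_eq_one_or (Int.negOnePow a) with h | h <;> simp [sgn, h]

/-- Induction on homogeneous elements of a graded algebra generated by homogeneous elements. -/
theorem homogeneous_induction {k R Λ : Type} [Field k] [Ring R] [Algebra k R]
    (𝒜 : ℤ → Submodule k R) [GradedAlgebra 𝒜] {x : Λ → R} {w : Λ → ℤ}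
    (hx : ∀ α, x α ∈ 𝒜 (w α)) (hgen : Algebra.adjoin k (Set.range x) = ⊤)
    (p : ℤ → R → Prop) (zero : ∀ i, p i 0)
    (add : ∀ i a b, p i a → p i b → p i (a + b))
    (smul : ∀ i (c : k) a, p i a → p i (c • a))
    (one : p 0 1)
    (gen_mul : ∀ α i a, a ∈ 𝒜 i → p i a → p (w α + i) (x α * a))
    ⦃i : ℤ⦄ ⦃a : R⦄ (ha : a ∈ 𝒜 i) : p i a := by
  have mono : ∀ b ∈ Submonoid.closure (Set.range x), ∃ j, b ∈ 𝒜 j ∧ p j b := by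
    intro b hb
    induction hb using Submonoid.closure_induction_left with
    | one => exact ⟨0, SetLike.GradedOne.one_mem, one⟩
    | mul_left z hz c _ ih =>
      obtain ⟨α, rfl⟩ := hz
      obtain ⟨j, hc, hp⟩ := ih
      exact ⟨w α + j, SetLike.GradedMul.mul_mem (hx α) hc, gen_mul α j c hc hp⟩
  have hspan : a ∈ Submodule.span k (Submonoid.closure (Set.range x) : Set R) := by
    rw [← Algebra.adjoin_eq_span, hgen]
    trivial
  have hproj : ∀ b ∈ Submodule.span k (Submonoid.closure (Set.range x) : Set R),
      p i (DirectSum.decompose 𝒜 b i : R) := by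
    intro b hb
    induction hb using Submodule.span_induction with
    | zero => simpa using zero i
    | add b c _ _ hb hc => simpa using add i _ _ hb hc
    | smul c b _ hb =>
      rw [DirectSum.decompose_smul]
      exact smul i c _ hb
    | mem b hb =>
      obtain ⟨j, hb, hp⟩ := mono b hb
      by_cases hij : j = i
      · subst hij
        rwa [DirectSum.decompose_of_mem_same 𝒜 hb]
      · rw [DirectSum.decompose_of_mem_ne 𝒜 hb hij]
        exact zero i
  simpa [DirectSum.decompose_of_mem_same 𝒜 ha] using hproj a hspan

/-- Linear maps agreeing on homogeneous elements agree. -/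
theorem eq_of_homogeneous {k R T : Type} [Field k] [Ring R] [Algebra k R]
    [AddCommGroup T] [Module k T] (𝒜 : ℤ → Submodule k R) [GradedAlgebra 𝒜]
    (f g : R →ₗ[k] T) (h : ∀ ⦃i : ℤ⦄ ⦃a : R⦄, a ∈ 𝒜 i → f a = g a) (a : R) : f a = g a := by
  induction a using DirectSum.Decomposition.inductionOn 𝒜 with
  | zero => simp
  | homogeneous a => exact h a.2
  | add a b ha hb => simp [ha, hb]

/-- Homogeneous elements lift to homogeneous elements of the same degree along a surjective
graded map. -/
theorem exists_homogeneous_lift {k R B : Type} [Field k] [Ring R] [Algebra k R]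
    [Ring B] [Algebra k B] (𝒜 : ℤ → Submodule k R) [GradedAlgebra 𝒜]
    (ℬ : ℤ → Submodule k B) [GradedAlgebra ℬ] (π : R →ₐ[k] B) (hπ : Function.Surjective π)
    (hmem : ∀ ⦃i : ℤ⦄ ⦃a : R⦄, a ∈ 𝒜 i → π a ∈ ℬ i)
    ⦃i : ℤ⦄ ⦃b : B⦄ (hb : b ∈ ℬ i) : ∃ a ∈ 𝒜 i, π a = b := by
  obtain ⟨r, rfl⟩ := hπ b
  have key : ∀ r : R, π (DirectSum.decompose 𝒜 r i : R) = (DirectSum.decompose ℬ (π r) i : B) := by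
    intro r
    induction r using DirectSum.Decomposition.inductionOn 𝒜 with
    | zero => simp
    | @homogeneous j a =>
      by_cases hij : j = i
      · subst hij
        rw [DirectSum.decompose_of_mem_same 𝒜 a.2, DirectSum.decompose_of_mem_same ℬ (hmem a.2)]
      · rw [DirectSum.decompose_of_mem_ne 𝒜 a.2 hij, DirectSum.decompose_of_mem_ne ℬ (hmem a.2) hij,
          map_zero]
    | add a b ha hb => simp [ha, hb]
  exact ⟨_, (DirectSum.decompose 𝒜 r i).2, by rw [key, DirectSum.decompose_of_mem_same ℬ hb]⟩

/-- `H` satisfies `H(ab) = M(a)H(b) + (-1)^{|a||b|}M(b)H(a)` on homogeneous elements. -/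
def IsGradedDerivationAlong {k R T : Type} [Field k] [Ring R] [Algebra k R] [Ring T] [Algebra k T]
    (𝒜 : ℤ → Submodule k R) (M : R →ₐ[k] T) (H : R →ₗ[k] T) : Prop :=
  ∀ ⦃i j : ℤ⦄ ⦃a b : R⦄, a ∈ 𝒜 i → b ∈ 𝒜 j →
    H (a * b) = M a * H b + sgn (i * j) • (M b * H a)

section Bracket

variable {k R T Λ : Type} [Field k] [Ring R] [Algebra k R] [Ring T] [Algebra k T]
  {𝒜 : ℤ → Submodule k R} [GradedAlgebra 𝒜] (P : DGPoissonAlgebra k R 𝒜)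
  {x : Λ → R} {w : Λ → ℤ} (hx : ∀ α, x α ∈ 𝒜 (w α))
  (hgen : Algebra.adjoin k (Set.range x) = ⊤)
  {M : R →ₐ[k] T} {H : R →ₗ[k] T} (hH : IsGradedDerivationAlong 𝒜 M H)

theorem IsGradedDerivationAlong.map_one (hH : IsGradedDerivationAlong 𝒜 M H) : H 1 = 0 := by
  have h := hH (i := 0) (j := 0) (a := 1) (b := 1)
    SetLike.GradedOne.one_mem SetLike.GradedOne.one_mem
  simpa [sgn_zero] using h

theorem DGPoissonAlgebra.br_one ⦃i : ℤ⦄ ⦃a : R⦄ (ha : a ∈ 𝒜 i) : P.br a 1 = 0 := by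
  have h := P.leibniz (j := 0) (l := 0) (b := 1) (c := 1) ha
    SetLike.GradedOne.one_mem SetLike.GradedOne.one_mem
  simpa [sgn_zero] using h

theorem DGPoissonAlgebra.one_br ⦃i : ℤ⦄ ⦃a : R⦄ (ha : a ∈ 𝒜 i) : P.br 1 a = 0 := by
  have h := P.antisymm (i := 0) (a := 1) SetLike.GradedOne.one_mem ha
  rwa [P.br_one ha, smul_zero, neg_zero] at h

theorem DGPoissonAlgebra.d_one : P.d 1 = 0 := by
  have h := P.d_mul (i := 0) (j := 0) (a := 1) (b := 1)
    SetLike.GradedOne.one_mem SetLike.GradedOne.one_mem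
  simpa [sgn_zero] using h

theorem DGPoissonAlgebra.mul_br ⦃i j l : ℤ⦄ ⦃a b c : R⦄ (ha : a ∈ 𝒜 i) (hb : b ∈ 𝒜 j)
    (hc : c ∈ 𝒜 l) : P.br (a * b) c = a * P.br b c + sgn (i * j) • (b * P.br a c) := by
  rw [P.antisymm (SetLike.GradedMul.mul_mem ha hb) hc, P.leibniz hc ha hb,
    P.antisymm hc ha, P.antisymm hc hb, neg_mul, smul_mul_assoc,
    P.gcomm (P.br_mem ha hc) hb, mul_comm l i, mul_comm l j, add_mul, add_mul, mul_comm l j]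
  simp only [sgn_add]
  rcases sgn_eq_one_or (i * l) with h1 | h1 <;> rcases sgn_eq_one_or (i * j) with h2 | h2 <;>
    rcases sgn_eq_one_or (j * l) with h3 | h3 <;>
    simp [h1, h2, h3]

include hx hgen hH

theorem mixed_bracket
    (h : ∀ α β, M (P.br (x α) (x β)) =
      H (x α) * M (x β) - sgn (w α * w β) • (M (x β) * H (x α)))
    ⦃i j : ℤ⦄ ⦃a b : R⦄ (ha : a ∈ 𝒜 i) (hb : b ∈ 𝒜 j) :
    M (P.br a b) = H a * M b - sgn (i * j) • (M b * H a) := by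
  have right : ∀ α ⦃j : ℤ⦄ ⦃b : R⦄, b ∈ 𝒜 j →
      M (P.br (x α) b) = H (x α) * M b - sgn (w α * j) • (M b * H (x α)) := by
    intro α
    refine homogeneous_induction 𝒜 hx hgen _ ?_ ?_ ?_ ?_ ?_
    · simp
    · intro i a b ha hb
      simp only [map_add, ha, hb, mul_add, add_mul, smul_add]
      abel
    · intro i c a ha
      simp only [map_smul, ha, mul_smul_comm, smul_mul_assoc, smul_sub, smul_comm c (sgn _)]
    · simp [P.br_one (hx α), sgn_zero]
    · intro β j b hb ih
      rw [P.leibniz (hx α) (hx β) hb, mul_add, sgn_add]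
      simp only [map_add, map_mul, map_zsmul, h, ih]
      rcases sgn_eq_one_or (w α * w β) with h1 | h1 <;>
        rcases sgn_eq_one_or (w α * j) with h2 | h2 <;>
        simp only [h1, h2] <;> noncomm_ring
  revert i a
  refine homogeneous_induction 𝒜 hx hgen _ ?_ ?_ ?_ ?_ ?_
  · simp
  · intro i a b ha hb
    simp only [map_add, LinearMap.add_apply, ha, hb, mul_add, add_mul, smul_add]
    abel
  · intro i c a ha
    simp only [map_smul, LinearMap.smul_apply, ha, mul_smul_comm, smul_mul_assoc, smul_sub,
      smul_comm c (sgn _)]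
  · simp [P.one_br hb, hH.map_one]
  · intro α i a ha ih
    have hc := congrArg M (P.gcomm hb (hx α))
    have hc' := congrArg M (P.gcomm hb ha)
    simp only [map_mul, map_zsmul] at hc hc'
    rw [P.mul_br (hx α) ha hb, hH (hx α) ha, add_mul (w α) i j, sgn_add]
    simp only [map_add, map_mul, map_zsmul, right α hb, ih]
    rw [mul_add, ← mul_assoc, hc, mul_smul_comm, ← mul_assoc, hc', mul_comm j, mul_comm j]
    rcases sgn_eq_one_or (w α * i) with h1 | h1 <;>
      rcases sgn_eq_one_or (w α * j) with h2 | h2 <;>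
      rcases sgn_eq_one_or (i * j) with h3 | h3 <;>
      simp only [h1, h2, h3] <;> noncomm_ring

theorem lie_bracket
    (h : ∀ α β, M (P.br (x α) (x β)) =
      H (x α) * M (x β) - sgn (w α * w β) • (M (x β) * H (x α)))
    (h' : ∀ α β, H (P.br (x α) (x β)) =
      H (x α) * H (x β) - sgn (w α * w β) • (H (x β) * H (x α)))
    ⦃i j : ℤ⦄ ⦃a b : R⦄ (ha : a ∈ 𝒜 i) (hb : b ∈ 𝒜 j) :
    H (P.br a b) = H a * H b - sgn (i * j) • (H b * H a) := by
  have right : ∀ ⦃i : ℤ⦄ ⦃a : R⦄, a ∈ 𝒜 i →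
      (∀ β, H (P.br a (x β)) = H a * H (x β) - sgn (i * w β) • (H (x β) * H a)) →
      ∀ ⦃j : ℤ⦄ ⦃b : R⦄, b ∈ 𝒜 j →
      H (P.br a b) = H a * H b - sgn (i * j) • (H b * H a) := by
    intro i a ha hgena
    refine homogeneous_induction 𝒜 hx hgen _ ?_ ?_ ?_ ?_ ?_
    · simp
    · intro i a b ha hb
      simp only [map_add, ha, hb, mul_add, add_mul, smul_add]
      abel
    · intro i c a ha
      simp only [map_smul, ha, mul_smul_comm, smul_mul_assoc, smul_sub, smul_comm c (sgn _)]
    · simp [P.br_one ha, hH.map_one]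
    · intro β j b hb ih
      rw [P.leibniz ha (hx β) hb, map_add, map_zsmul, hH (P.br_mem ha (hx β)) hb,
        hH (hx β) (P.br_mem ha hb), hH (hx β) hb,
        mixed_bracket P hx hgen hH h ha (hx β), mixed_bracket P hx hgen hH h ha hb, ih, hgena,
        mul_add i, add_mul i, mul_add (w β), mul_comm (w β) i]
      simp only [sgn_add]
      rcases sgn_eq_one_or (i * w β) with h1 | h1 <;>
        rcases sgn_eq_one_or (w β * j) with h2 | h2 <;>
        rcases sgn_eq_one_or (i * j) with h3 | h3 <;>
        simp only [h1, h2, h3] <;> noncomm_ring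
  refine right ha (fun β => ?_) hb
  rw [P.antisymm ha (hx β), map_neg, map_zsmul, right (hx β) (h' β) ha, mul_comm (w β) i]
  rcases sgn_eq_one_or (i * w β) with h1 | h1 <;> simp only [h1] <;> noncomm_ring

end Bracket


section Derivation

variable {k R T Λ : Type} [Field k] [Ring R] [Algebra k R] [Ring T] [Algebra k T]
  {𝒜 : ℤ → Submodule k R} [GradedAlgebra 𝒜]
  {x : Λ → R} {w : Λ → ℤ} (hx : ∀ α, x α ∈ 𝒜 (w α))
  (hgen : Algebra.adjoin k (Set.range x) = ⊤)
  {M : R →ₐ[k] T}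

include hx hgen

theorem IsGradedDerivationAlong.ext {H H' : R →ₗ[k] T} (hH : IsGradedDerivationAlong 𝒜 M H)
    (hH' : IsGradedDerivationAlong 𝒜 M H') (h : ∀ α, H (x α) = H' (x α)) (a : R) :
    H a = H' a := by
  refine eq_of_homogeneous 𝒜 H H' (homogeneous_induction 𝒜 hx hgen _ ?_ ?_ ?_ ?_ ?_) a
  · simp
  · intro i a b ha hb
    simp [ha, hb]
  · intro i c a ha
    simp [ha]
  · rw [hH.map_one, hH'.map_one]
  · intro α i a ha ih
    rw [hH (hx α) ha, hH' (hx α) ha, h, ih]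

/-- Two degree-one graded derivations along the same algebra map agree if they agree on
homogeneous generators. -/
theorem differential_ext {δ δ' : R →ₗ[k] T}
    (hδ : ∀ ⦃i j : ℤ⦄ ⦃a b : R⦄, a ∈ 𝒜 i → b ∈ 𝒜 j →
      δ (a * b) = δ a * M b + sgn i • (M a * δ b))
    (hδ' : ∀ ⦃i j : ℤ⦄ ⦃a b : R⦄, a ∈ 𝒜 i → b ∈ 𝒜 j →
      δ' (a * b) = δ' a * M b + sgn i • (M a * δ' b))
    (h : ∀ α, δ (x α) = δ' (x α)) (a : R) : δ a = δ' a := by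
  have one : (1 : R) ∈ 𝒜 0 := SetLike.GradedOne.one_mem
  refine eq_of_homogeneous 𝒜 δ δ' (homogeneous_induction 𝒜 hx hgen _ ?_ ?_ ?_ ?_ ?_) a
  · simp
  · intro i a b ha hb
    simp [ha, hb]
  · intro i c a ha
    simp [ha]
  · have h1 := hδ one one
    have h2 := hδ' one one
    simp only [mul_one, one_mul, map_one, sgn_zero, one_smul, left_eq_add] at h1 h2
    rw [h1, h2]
  · intro α i a ha ih
    rw [hδ (hx α) ha, hδ' (hx α) ha, h, ih]

/-- A graded derivation along `M` commutes with compatible differentials as soon as it does so on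
homogeneous generators. -/
theorem IsGradedDerivationAlong.comm_differential {H : R →ₗ[k] T}
    (hH : IsGradedDerivationAlong 𝒜 M H) (P : DGPoissonAlgebra k R 𝒜)
    {𝒯 : ℤ → Submodule k T} {D : T →ₗ[k] T}
    (hM : ∀ ⦃i : ℤ⦄ ⦃a : R⦄, a ∈ 𝒜 i → M a ∈ 𝒯 i)
    (hHmem : ∀ ⦃i : ℤ⦄ ⦃a : R⦄, a ∈ 𝒜 i → H a ∈ 𝒯 i)
    (hDmul : ∀ ⦃i j : ℤ⦄ ⦃u v : T⦄, u ∈ 𝒯 i → v ∈ 𝒯 j →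
      D (u * v) = D u * v + sgn i • (u * D v))
    (hDM : ∀ a, D (M a) = M (P.d a)) (h : ∀ α, H (P.d (x α)) = D (H (x α))) (a : R) :
    H (P.d a) = D (H a) := by
  refine eq_of_homogeneous 𝒜 (H ∘ₗ P.d) (D ∘ₗ H)
    (homogeneous_induction 𝒜 hx hgen _ ?_ ?_ ?_ ?_ ?_) a
  · simp
  · intro i a b ha hb
    simp only [map_add, ha, hb]
  · intro i c a ha
    simp only [map_smul, ha]
  · simp [P.d_one, hH.map_one]
  · intro α i a ha ih
    simp only [LinearMap.comp_apply] at ih ⊢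
    rw [P.d_mul (hx α) ha, map_add, map_zsmul, hH (P.d_mem (hx α)) ha, hH (hx α) (P.d_mem ha),
      hH (hx α) ha, map_add, map_zsmul, hDmul (hM (hx α)) (hHmem ha),
      hDmul (hM ha) (hHmem (hx α)), hDM, hDM, h, ih, add_mul, mul_add, one_mul, mul_one]
    simp only [sgn_add]
    rcases sgn_eq_one_or (w α) with h1 | h1 <;>
      rcases sgn_eq_one_or i with h2 | h2 <;>
      rcases sgn_eq_one_or (w α * i) with h3 | h3 <;>
      simp only [h1, h2, h3] <;> noncomm_ring

end Derivation

/-- An algebra map vanishing on the kernel of a surjective algebra map descends along it. -/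
theorem exists_algHom_comp_eq {k F C D : Type} [Field k] [Ring F] [Algebra k F]
    [Ring C] [Algebra k C] [Ring D] [Algebra k D] (π : F →ₐ[k] C) (hπ : Function.Surjective π)
    (Φ : F →ₐ[k] D) (hker : ∀ u, π u = 0 → Φ u = 0) :
    ∃ φ : C →ₐ[k] D, ∀ u, φ (π u) = Φ u := by
  have hΦ : ∀ u v, π u = π v → Φ u = Φ v := fun u v huv =>
    sub_eq_zero.1 (by rw [← map_sub]; exact hker _ (by rw [map_sub, huv, sub_self]))
  have hs : ∀ u, Φ (Function.surjInv hπ (π u)) = Φ u := fun u =>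
    hΦ _ _ (Function.surjInv_eq hπ _)
  refine ⟨AlgHom.ofLinearMap
    { toFun := fun c => Φ (Function.surjInv hπ c)
      map_add' := ?_
      map_smul' := ?_ } ?_ ?_, hs⟩
  · intro a b
    obtain ⟨u, rfl⟩ := hπ a
    obtain ⟨v, rfl⟩ := hπ b
    rw [← map_add, hs, hs, hs, map_add]
  · intro c a
    obtain ⟨u, rfl⟩ := hπ a
    rw [← map_smul, hs, hs, map_smul, RingHom.id_apply]
  · change Φ (Function.surjInv hπ 1) = 1
    rw [← map_one π, hs, map_one]
  · intro a b
    change Φ (Function.surjInv hπ (a * b)) =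
      Φ (Function.surjInv hπ a) * Φ (Function.surjInv hπ b)
    obtain ⟨u, rfl⟩ := hπ a
    obtain ⟨v, rfl⟩ := hπ b
    rw [← map_mul, hs, hs, hs, map_mul]

section PsiF

variable {k R F Λ : Type} [Field k] [Ring R] [Algebra k R] [Ring F] [Algebra k F]
  {ι : R →ₐ[k] F} {ψ : Λ → R →ₗ[k] R} {y : Λ → F}

theorem psiF_hasFiniteSupport (hψfin : ∀ a : R, (Function.support fun α => ψ α a).Finite) (a : R) :
    (Function.support fun α => ι (ψ α a) * y α).Finite :=
  (hψfin a).subset fun α hα h0 => hα (by simp [show ψ α a = 0 from h0])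

theorem exists_psiF_linearMap (hψfin : ∀ a : R, (Function.support fun α => ψ α a).Finite) :
    ∃ Ψ : R →ₗ[k] F, ∀ a, Ψ a = psiF ι ψ y a := by
  refine ⟨{ toFun := psiF ι ψ y, map_add' := fun a b => ?_, map_smul' := fun c a => ?_ },
    fun a => rfl⟩
  · simp only [psiF, map_add, add_mul]
    exact finsum_add_distrib (psiF_hasFiniteSupport hψfin a) (psiF_hasFiniteSupport hψfin b)
  · simp only [psiF, map_smul, smul_mul_assoc, RingHom.id_apply]
    exact (smul_finsum' c (psiF_hasFiniteSupport hψfin a)).symm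

theorem psiF_mul {𝒜 : ℤ → Submodule k R}
    (hψfin : ∀ a : R, (Function.support fun α => ψ α a).Finite)
    (hψmul : ∀ (α : Λ) ⦃i j : ℤ⦄ ⦃a b : R⦄, a ∈ 𝒜 i → b ∈ 𝒜 j →
      ψ α (a * b) = a * ψ α b + sgn (i * j) • (b * ψ α a))
    ⦃i j : ℤ⦄ ⦃a b : R⦄ (ha : a ∈ 𝒜 i) (hb : b ∈ 𝒜 j) :
    psiF ι ψ y (a * b) = ι a * psiF ι ψ y b + sgn (i * j) • (ι b * psiF ι ψ y a) := by
  have hfin : ∀ a b : R, (Function.support fun α => ι b * (ι (ψ α a) * y α)).Finite := fun a b =>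
    (hψfin a).subset fun α hα h0 => hα (by simp [show ψ α a = 0 from h0])
  rw [psiF, psiF, psiF, mul_finsum' _ _ (psiF_hasFiniteSupport hψfin b),
    mul_finsum' _ _ (psiF_hasFiniteSupport hψfin a), smul_finsum' _ (hfin a b),
    ← finsum_add_distrib (hfin b a)
      ((hψfin a).subset fun α hα h0 => hα (by simp [show ψ α a = 0 from h0]))]
  refine finsum_congr fun α => ?_
  rw [hψmul α ha hb, map_add, map_zsmul, map_mul, map_mul, add_mul, smul_mul_assoc, mul_assoc,
    mul_assoc]

theorem psiF_gen {x : Λ → R} (hψx : ∀ α, ψ α (x α) = 1) (hψx' : ∀ α β, α ≠ β → ψ α (x β) = 0)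
    (α : Λ) : psiF ι ψ y (x α) = y α := by
  rw [psiF, finsum_eq_single _ α fun β hβ => by rw [hψx' β α hβ, map_zero, zero_mul], hψx, map_one,
    one_mul]

theorem psiF_mem {𝒜 : ℤ → Submodule k R} {ℱ : ℤ → Submodule k F} [GradedAlgebra ℱ] {w : Λ → ℤ}
    (hψmem : ∀ (α : Λ) ⦃i : ℤ⦄ ⦃a : R⦄, a ∈ 𝒜 i → ψ α a ∈ 𝒜 (i - w α))
    (hι : ∀ ⦃i : ℤ⦄ ⦃a : R⦄, a ∈ 𝒜 i → ι a ∈ ℱ i) (hy : ∀ α, y α ∈ ℱ (w α))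
    ⦃i : ℤ⦄ ⦃a : R⦄ (ha : a ∈ 𝒜 i) : psiF ι ψ y a ∈ ℱ i := by
  refine finsum_induction (· ∈ ℱ i) (zero_mem _) (fun _ _ => add_mem) fun α => ?_
  simpa using SetLike.GradedMul.mul_mem (hι (hψmem α ha)) (hy α)

end PsiF

/-- With `A = R/I` and `𝒜 = F(R)/J` (with the induced differential),
the maps `m(f + I) = f + J` and `h(f + I) = ψ(f) + J` make `(𝒜, m, h)` a universal
enveloping algebra of the DG Poisson algebra `A`. -/
theorem stmt4 (k R F C A : Type) [Field k] [Ring R] [Algebra k R] [Ring F] [Algebra k F]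
    [Ring C] [Algebra k C] [Ring A] [Algebra k A] (Λ : Type)
    (𝒜 : ℤ → Submodule k R) [GradedAlgebra 𝒜]
    (ℱ : ℤ → Submodule k F) [GradedAlgebra ℱ]
    (𝒞 : ℤ → Submodule k C) [GradedAlgebra 𝒞]
    (ℬ : ℤ → Submodule k A) [GradedAlgebra ℬ]
    (P : DGPoissonAlgebra k R 𝒜)
    (x : Λ → R) (w : Λ → ℤ) (hx : ∀ α, x α ∈ 𝒜 (w α))
    (hgen : Algebra.adjoin k (Set.range x) = ⊤)
    (ψ : Λ → R →ₗ[k] R)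
    (hψx : ∀ α, ψ α (x α) = 1) (hψx' : ∀ α β, α ≠ β → ψ α (x β) = 0)
    (hψmem : ∀ (α : Λ) ⦃i : ℤ⦄ ⦃a : R⦄, a ∈ 𝒜 i → ψ α a ∈ 𝒜 (i - w α))
    (hψmul : ∀ (α : Λ) ⦃i j : ℤ⦄ ⦃a b : R⦄, a ∈ 𝒜 i → b ∈ 𝒜 j →
      ψ α (a * b) = a * ψ α b + sgn (i * j) • (b * ψ α a))
    (hψfin : ∀ a : R, (Function.support fun α => ψ α a).Finite)
    -- `F = R⟨y_α | α ∈ Λ⟩`: the free `R`-ring on the `y_α`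
    (ι : R →ₐ[k] F) (hι : ∀ ⦃i : ℤ⦄ ⦃a : R⦄, a ∈ 𝒜 i → ι a ∈ ℱ i)
    (y : Λ → F) (hy : ∀ α, y α ∈ ℱ (w α))
    (hFgen : Algebra.adjoin k ((Set.range fun α => ι (x α)) ∪ Set.range y) = ⊤)
    (hFuniv : ∀ (D : Type) [Ring D] [Algebra k D] (ρ : R →ₐ[k] D) (v : Λ → D),
      ∃! Φ : F →ₐ[k] D, Φ.comp ι = ρ ∧ ∀ α, Φ (y α) = v α)
    -- the DG Poisson ideal `I` and the quotient `A = R/I`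
    (I : Submodule k R) (hI : IsDGPoissonIdeal k 𝒜 P I)
    (π' : R →ₐ[k] A) (hπ' : IsQuotientBy k π' I)
    (hπ'mem : ∀ ⦃i : ℤ⦄ ⦃a : R⦄, a ∈ 𝒜 i → π' a ∈ ℬ i)
    (PA : DGPoissonAlgebra k A ℬ)
    (hPAd : ∀ r : R, PA.d (π' r) = π' (P.d r))
    (hPAbr : ∀ r s : R, PA.br (π' r) (π' s) = π' (P.br r s))
    -- the derivation `∂` of `F(R)`
    (D : F →ₗ[k] F)
    (hDmem : ∀ ⦃i : ℤ⦄ ⦃u : F⦄, u ∈ ℱ i → D u ∈ ℱ (i + 1))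
    (hDx : ∀ α, D (ι (x α)) = ι (P.d (x α)))
    (hDy : ∀ α, D (y α) = psiF ι ψ y (P.d (x α)))
    (hDmul : ∀ ⦃i j : ℤ⦄ ⦃u v : F⦄, u ∈ ℱ i → v ∈ ℱ j →
      D (u * v) = D u * v + sgn i • (u * D v))
    -- the quotient `𝒞 = F(R)/J` with its induced differential
    (πe : F →ₐ[k] C) (hπe : IsQuotientBy k πe (idealGen k (Jgens 𝒜 P x w ι ψ y I)))
    (hπemem : ∀ ⦃i : ℤ⦄ ⦃u : F⦄, u ∈ ℱ i → πe u ∈ 𝒞 i)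
    (DC : DGAlgebra k C 𝒞) (hDC : ∀ u : F, DC.d (πe u) = πe (D u))
    -- the structure maps `m` and `h`
    (m : A →ₐ[k] C) (hm : ∀ r : R, m (π' r) = πe (ι r))
    (h : A →ₗ[k] C) (hh : ∀ r : R, h (π' r) = πe (psiF ι ψ y r)) :
    IsUEA k ℬ 𝒞 PA DC m h := by
  obtain ⟨Ψ, hΨ⟩ := exists_psiF_linearMap (ι := ι) (y := y) hψfin
  have hΨmul : IsGradedDerivationAlong 𝒜 ι Ψ := by
    intro i j a b ha hb
    simp only [hΨ]
    exact psiF_mul hψfin hψmul ha hb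
  have hΨx : ∀ α, Ψ (x α) = y α := fun α => (hΨ _).trans (psiF_gen hψx hψx' α)
  have hΨmem : ∀ ⦃i : ℤ⦄ ⦃a : R⦄, a ∈ 𝒜 i → Ψ a ∈ ℱ i := by
    intro i a ha
    rw [hΨ]
    exact psiF_mem hψmem hι hy ha
  simp only [← hΨ] at hh hDy
  have hDι : ∀ r, D (ι r) = ι (P.d r) := by
    refine differential_ext hx hgen (M := ι) (δ := D ∘ₗ ι.toLinearMap)
      (δ' := ι.toLinearMap ∘ₗ P.d) ?_ ?_ ?_
    · intro i j a b ha hb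
      simp [hDmul (hι ha) (hι hb)]
    · intro i j a b ha hb
      simp [P.d_mul ha hb]
    · simpa using hDx
  have hDΨ : ∀ r, Ψ (P.d r) = D (Ψ r) :=
    hΨmul.comm_differential hx hgen P hι hΨmem hDmul hDι fun α => by rw [hΨx, hDy]
  have hJ : ∀ s ∈ Jgens 𝒜 P x w ι ψ y I, πe s = 0 := fun s hs =>
    (hπe.ker s).2 (Submodule.subset_span ⟨1, 1, s, hs, by simp⟩)
  have hΨC : IsGradedDerivationAlong 𝒜 (πe.comp ι) (πe.toLinearMap ∘ₗ Ψ) := by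
    intro i j a b ha hb
    simp [hΨmul ha hb]
  have hmixed : ∀ α β, πe.comp ι (P.br (x α) (x β)) =
      (πe.toLinearMap ∘ₗ Ψ) (x α) * πe.comp ι (x β) -
        sgn (w α * w β) • (πe.comp ι (x β) * (πe.toLinearMap ∘ₗ Ψ) (x α)) := by
    intro α β
    have := hJ _ (Or.inr ⟨α, β, rfl⟩)
    rw [map_sub, sub_eq_zero] at this
    simpa [hΨx] using this.symm
  have hlie : ∀ α β, (πe.toLinearMap ∘ₗ Ψ) (P.br (x α) (x β)) =
      (πe.toLinearMap ∘ₗ Ψ) (x α) * (πe.toLinearMap ∘ₗ Ψ) (x β) -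
        sgn (w α * w β) • ((πe.toLinearMap ∘ₗ Ψ) (x β) * (πe.toLinearMap ∘ₗ Ψ) (x α)) := by
    intro α β
    have := hJ _ (Or.inl (Or.inr ⟨α, β, rfl⟩))
    rw [map_sub, sub_eq_zero, ← hΨ] at this
    simpa [hΨx] using this.symm
  have lift := exists_homogeneous_lift 𝒜 ℬ π' hπ'.surj hπ'mem
  refine ⟨⟨⟨?_, ?_⟩, ?_, ?_, ?_, ?_, ?_⟩, ?_⟩
  · intro i a ha
    obtain ⟨r, hr, rfl⟩ := lift ha
    rw [hm]
    exact hπemem (hι hr)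
  · intro a
    obtain ⟨r, rfl⟩ := hπ'.surj a
    rw [hPAd, hm, hm, hDC, hDι]
  · intro i a ha
    obtain ⟨r, hr, rfl⟩ := lift ha
    rw [hh]
    exact hπemem (hΨmem hr)
  · intro a
    obtain ⟨r, rfl⟩ := hπ'.surj a
    rw [hPAd, hh, hh, hDC, hDΨ]
  · intro i j a b ha hb
    obtain ⟨r, hr, rfl⟩ := lift ha
    obtain ⟨s, hs, rfl⟩ := lift hb
    rw [hPAbr, hh, hh, hh]
    exact lie_bracket P hx hgen hΨC hmixed hlie hr hs
  · intro i j a b ha hb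
    obtain ⟨r, hr, rfl⟩ := lift ha
    obtain ⟨s, hs, rfl⟩ := lift hb
    rw [hPAbr, hh, hm, hm]
    exact mixed_bracket P hx hgen hΨC hmixed hr hs
  · intro i j a b ha hb
    obtain ⟨r, hr, rfl⟩ := lift ha
    obtain ⟨s, hs, rfl⟩ := lift hb
    rw [← map_mul, hh, hh, hh, hm, hm]
    exact hΨC hr hs
  intro E _ _ ℰ _ dE f g ⟨⟨hf, hfd⟩, hg, hgd, hgbr, hfbr, hgmul⟩
  obtain ⟨Φ, ⟨hΦι, hΦy⟩, hΦuniq⟩ := hFuniv E (f.comp π') fun α => g (π' (x α))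
  replace hΦι : ∀ r, Φ (ι r) = f (π' r) := fun r => DFunLike.congr_fun hΦι r
  have hΦΨ : ∀ r, Φ (Ψ r) = g (π' r) := by
    refine IsGradedDerivationAlong.ext hx hgen (M := f.comp π') (H := Φ.toLinearMap ∘ₗ Ψ)
      (H' := g ∘ₗ π'.toLinearMap) ?_ ?_ ?_
    · intro i j a b ha hb
      simp [hΨmul ha hb, hΦι]
    · intro i j a b ha hb
      simp [hgmul (hπ'mem ha) (hπ'mem hb)]
    · simp [hΨx, hΦy]
  have hΦJ : ∀ s ∈ Jgens 𝒜 P x w ι ψ y I, Φ s = 0 := by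
    rintro s (((⟨r, hr, rfl⟩ | ⟨r, hr, rfl⟩) | ⟨α, β, rfl⟩) | ⟨α, β, rfl⟩)
    · rw [hΦι, (hπ'.ker r).2 hr, map_zero]
    · rw [← hΨ, hΦΨ, (hπ'.ker r).2 hr, map_zero]
    · rw [← hΨ, map_sub, map_sub, map_zsmul, map_mul, map_mul, hΦΨ, ← hPAbr,
        hgbr (hπ'mem (hx α)) (hπ'mem (hx β)), hΦy, hΦy, sub_self]
    · rw [map_sub, map_sub, map_zsmul, map_mul, map_mul, hΦι, hΦι, ← hPAbr,
        hfbr (hπ'mem (hx α)) (hπ'mem (hx β)), hΦy, sub_self]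
  have hΦker : ∀ u, πe u = 0 → Φ u = 0 := by
    intro u hu
    have hle : idealGen k (Jgens 𝒜 P x w ι ψ y I) ≤ LinearMap.ker Φ.toLinearMap := by
      refine Submodule.span_le.2 ?_
      rintro _ ⟨a, b, s, hs, rfl⟩
      simp [hΦJ s hs]
    exact hle ((hπe.ker u).1 hu)
  obtain ⟨φ, hφ⟩ := exists_algHom_comp_eq πe hπe.surj Φ hΦker
  have hz : ∀ γ, Sum.elim (fun α => ι (x α)) y γ ∈ ℱ (Sum.elim w w γ) := by
    rintro (α | α)
    · exact hι (hx α)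
    · exact hy α
  have hzgen : Algebra.adjoin k (Set.range (Sum.elim (fun α => ι (x α)) y)) = ⊤ := by
    rwa [Set.Sum.elim_range]
  have hΦmem : ∀ ⦃i : ℤ⦄ ⦃u : F⦄, u ∈ ℱ i → Φ u ∈ ℰ i := by
    refine homogeneous_induction ℱ hz hzgen _ ?_ ?_ ?_ ?_ ?_
    · simp
    · intro i a b ha hb
      rw [map_add]
      exact add_mem ha hb
    · intro i c a ha
      rw [map_smul]
      exact Submodule.smul_mem _ _ ha
    · rw [map_one]
      exact SetLike.GradedOne.one_mem
    · rintro (α | α) i a - ha <;> rw [map_mul] <;> refine SetLike.GradedMul.mul_mem ?_ ha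
      · simpa [hΦι] using hf (hπ'mem (hx α))
      · simpa [hΦy] using hg (hπ'mem (hx α))
  have hΦD : ∀ u, Φ (D u) = dE.d (Φ u) := by
    refine differential_ext hz hzgen (M := Φ) (δ := Φ.toLinearMap ∘ₗ D)
      (δ' := dE.d ∘ₗ Φ.toLinearMap) ?_ ?_ ?_
    · intro i j a b ha hb
      simp [hDmul ha hb]
    · intro i j a b ha hb
      simp [dE.d_mul (hΦmem ha) (hΦmem hb)]
    · rintro (α | α)
      · simp [hDx, hΦι, ← hPAd, hfd]
      · simp [hDy, hΦΨ, hΦy, ← hPAd, hgd]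
  refine ⟨φ, ⟨⟨?_, ?_⟩, ?_, ?_⟩, ?_⟩
  · intro i c hc
    obtain ⟨u, hu, rfl⟩ := exists_homogeneous_lift ℱ 𝒞 πe hπe.surj hπemem hc
    rw [hφ]
    exact hΦmem hu
  · intro c
    obtain ⟨u, rfl⟩ := hπe.surj c
    rw [hDC, hφ, hφ, hΦD]
  · ext a
    obtain ⟨r, rfl⟩ := hπ'.surj a
    simp [hm, hφ, hΦι]
  · ext a
    obtain ⟨r, rfl⟩ := hπ'.surj a
    simp [hh, hφ, hΦΨ]
  · rintro φ' ⟨-, hφ'm, hφ'h⟩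
    have hφ' : φ'.comp πe = Φ := by
      refine hΦuniq _ ⟨?_, fun α => ?_⟩
      · ext r
        simp [← hm, ← hφ'm]
      · simp [← hφ'h, hh, hΨx]
    ext c
    obtain ⟨u, rfl⟩ := hπe.surj c
    rw [hφ, ← hφ', AlgHom.comp_apply]
end
end

section
/- Assume that either char k = 2 or every |x_i| is even, so that the monomials x_1^{i_1} ... x_n^{i_n} form a k-basis of R. If M ≠ R is a DG ideal of R (a graded ideal with d(M) ⊆ M) and Q is a DG Poisson ideal of R (a DG ideal with {R, Q} ⊆ Q) with Q ⊆ M, then R^e m_R(M) + R^e h_R(Q) R^e ≠ R^e. -/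
noncomputable section

open scoped DirectSum

section SignTrivial

variable {k R : Type} [Field k] [Ring R] [Algebra k R] {𝒜 : ℤ → Submodule k R}

lemma sgn_of_even {m : ℤ} (hm : Even m) : sgn m = 1 := by
  simp [sgn, Int.negOnePow_even m hm]

lemma sgn_cast_of_ringChar_eq_two (hk : ringChar k = 2) (m : ℤ) : (sgn m : k) = 1 := by
  have : CharP k 2 := ringChar.of_eq hk
  rcases Int.even_or_odd m with hm | hm
  · simp [sgn_of_even hm]
  · simp [sgn, Int.negOnePow_odd m hm, CharTwo.neg_eq]

/-- Signs coming from the grading `𝒜` act trivially: either all signs are `1` in `k`, or `𝒜` is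
concentrated in even degrees. -/
def SignTrivial (𝒜 : ℤ → Submodule k R) : Prop :=
  (∀ m, (sgn m : k) = 1) ∨ ∀ i, ¬ Even i → 𝒜 i = ⊥

lemma sgn_smul_of_cast_eq_one {X : Type} [AddCommGroup X] [Module k X] {m : ℤ}
    (hm : (sgn m : k) = 1) (z : X) : sgn m • z = z := by
  rw [← Int.cast_smul_eq_zsmul k, hm, one_smul]

lemma SignTrivial.sgn_mul_smul (hs : SignTrivial 𝒜) {X : Type} [AddCommGroup X] [Module k X]
    {i : ℤ} {a : R} (ha : a ∈ 𝒜 i) (j : ℤ) {z : X} (hz : a = 0 → z = 0) :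
    sgn (i * j) • z = z := by
  rcases hs with hs | hs
  · exact sgn_smul_of_cast_eq_one (hs _) z
  · by_cases hi : Even i
    · rw [sgn_of_even (hi.mul_right j), one_smul]
    · rw [hs i hi, Submodule.mem_bot] at ha
      rw [hz ha, smul_zero]

lemma SignTrivial.sgn_smul (hs : SignTrivial 𝒜) {X : Type} [AddCommGroup X] [Module k X]
    {i : ℤ} {a : R} (ha : a ∈ 𝒜 i) {z : X} (hz : a = 0 → z = 0) : sgn i • z = z := by
  simpa using hs.sgn_mul_smul ha 1 hz

variable [GradedAlgebra 𝒜]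

/-- A graded algebra spanned by monomials in generators of even degree is concentrated in even
degrees. -/
lemma eq_bot_of_span_xMono {n : ℕ} {x : Fin n → R} {w : Fin n → ℤ} (hx : ∀ i, x i ∈ 𝒜 (w i))
    (hw : ∀ i, Even (w i))
    (hspan : Submodule.span k (Set.range fun e : Fin n → ℕ => xMono x e) = ⊤)
    {i : ℤ} (hi : ¬ Even i) : 𝒜 i = ⊥ := by
  have hproj : GradedAlgebra.proj 𝒜 i = 0 := by
    refine LinearMap.ext_on hspan ?_
    rintro _ ⟨e, rfl⟩
    have hmem : xMono x e ∈ 𝒜 ((List.finRange n).map fun r => e r • w r).sum :=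
      SetLike.list_prod_map_mem_graded _ _ _ fun j _ => SetLike.pow_mem_graded _ (hx j)
    have heven : Even ((List.finRange n).map fun r => e r • w r).sum := by
      refine even_iff_two_dvd.2 (List.dvd_sum fun z hz => ?_)
      obtain ⟨r, -, rfl⟩ := List.mem_map.1 hz
      rw [nsmul_eq_mul]
      exact ((hw r).mul_left _).two_dvd
    simp only [GradedAlgebra.proj_apply, LinearMap.zero_apply]
    exact DirectSum.decompose_of_mem_ne 𝒜 hmem (fun h => hi (h ▸ heven))
  refine (Submodule.eq_bot_iff _).2 fun a ha => ?_
  rw [← DirectSum.decompose_of_mem_same 𝒜 ha, ← GradedAlgebra.proj_apply, hproj,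
    LinearMap.zero_apply]

namespace DGPoissonAlgebra

lemma mul_comm_of_signTrivial (P : DGPoissonAlgebra k R 𝒜) (hs : SignTrivial 𝒜) (a b : R) :
    a * b = b * a := by
  induction a using DirectSum.Decomposition.inductionOn 𝒜 with
  | zero => simp
  | add a a' iha iha' => simp only [add_mul, mul_add, iha, iha']
  | homogeneous a =>
    induction b using DirectSum.Decomposition.inductionOn 𝒜 with
    | zero => simp
    | add b b' ihb ihb' => simp only [add_mul, mul_add, ihb, ihb']
    | homogeneous b =>
      exact (P.gcomm a.2 b.2).trans (hs.sgn_mul_smul a.2 _ fun h => by simp [h])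

variable (P : DGPoissonAlgebra k R 𝒜)

lemma br_antisymm_of_signTrivial (hs : SignTrivial 𝒜) (a b : R) : P.br a b = -P.br b a := by
  induction a using DirectSum.Decomposition.inductionOn 𝒜 with
  | zero => simp
  | add a a' iha iha' => simp only [map_add, LinearMap.add_apply, iha, iha']; abel
  | homogeneous a =>
    induction b using DirectSum.Decomposition.inductionOn 𝒜 with
    | zero => simp
    | add b b' ihb ihb' => simp only [map_add, LinearMap.add_apply, ihb, ihb']; abel
    | homogeneous b =>
      rw [P.antisymm a.2 b.2, hs.sgn_mul_smul a.2 _ fun h => by simp [h]]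

lemma br_mul_of_signTrivial (hs : SignTrivial 𝒜) (a b c : R) :
    P.br a (b * c) = P.br a b * c + b * P.br a c := by
  induction a using DirectSum.Decomposition.inductionOn 𝒜 with
  | zero => simp
  | add a a' iha iha' =>
    simp only [map_add, LinearMap.add_apply, iha, iha', add_mul, mul_add]; abel
  | homogeneous a =>
    induction b using DirectSum.Decomposition.inductionOn 𝒜 with
    | zero => simp
    | add b b' ihb ihb' => simp only [map_add, ihb, ihb', add_mul]; abel
    | homogeneous b =>
      induction c using DirectSum.Decomposition.inductionOn 𝒜 with
      | zero => simp
      | add c c' ihc ihc' => simp only [map_add, ihc, ihc', mul_add]; abel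
      | homogeneous c =>
        rw [P.leibniz a.2 b.2 c.2, hs.sgn_mul_smul a.2 _ fun h => by simp [h]]

lemma jacobi_of_signTrivial (hs : SignTrivial 𝒜) (a b c : R) :
    P.br a (P.br b c) = P.br (P.br a b) c + P.br b (P.br a c) := by
  induction a using DirectSum.Decomposition.inductionOn 𝒜 with
  | zero => simp
  | add a a' iha iha' => simp only [map_add, LinearMap.add_apply, iha, iha']; abel
  | homogeneous a =>
    induction b using DirectSum.Decomposition.inductionOn 𝒜 with
    | zero => simp
    | add b b' ihb ihb' => simp only [map_add, LinearMap.add_apply, ihb, ihb']; abel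
    | homogeneous b =>
      induction c using DirectSum.Decomposition.inductionOn 𝒜 with
      | zero => simp
      | add c c' ihc ihc' => simp only [map_add, ihc, ihc']; abel
      | homogeneous c =>
        rw [P.jacobi a.2 b.2 c.2, hs.sgn_mul_smul a.2 _ fun h => by simp [h]]

lemma d_mul_of_signTrivial (hs : SignTrivial 𝒜) (a b : R) :
    P.d (a * b) = P.d a * b + a * P.d b := by
  induction a using DirectSum.Decomposition.inductionOn 𝒜 with
  | zero => simp
  | add a a' iha iha' => simp only [map_add, iha, iha', add_mul]; abel
  | homogeneous a =>
    induction b using DirectSum.Decomposition.inductionOn 𝒜 with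
    | zero => simp
    | add b b' ihb ihb' => simp only [map_add, ihb, ihb', mul_add]; abel
    | homogeneous b => rw [P.d_mul a.2 b.2, hs.sgn_smul a.2 fun h => by simp [h]]

lemma d_br_of_signTrivial (hs : SignTrivial 𝒜) (a b : R) :
    P.d (P.br a b) = P.br (P.d a) b + P.br a (P.d b) := by
  induction a using DirectSum.Decomposition.inductionOn 𝒜 with
  | zero => simp
  | add a a' iha iha' => simp only [map_add, LinearMap.add_apply, iha, iha']; abel
  | homogeneous a =>
    induction b using DirectSum.Decomposition.inductionOn 𝒜 with
    | zero => simp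
    | add b b' ihb ihb' => simp only [map_add, ihb, ihb']; abel
    | homogeneous b => rw [P.d_br a.2 b.2, hs.sgn_smul a.2 fun h => by simp [h]]

lemma sgn_cast_eq_one_or_d_eq_zero (hs : SignTrivial 𝒜) :
    (∀ m, (sgn m : k) = 1) ∨ P.d = 0 := by
  refine hs.imp_right fun hodd => LinearMap.ext fun a => ?_
  induction a using DirectSum.Decomposition.inductionOn 𝒜 with
  | zero => simp
  | add a a' iha iha' => simp [iha, iha']
  | @homogeneous i a =>
    by_cases hi : Even i
    · have := P.d_mem a.2
      rwa [hodd (i + 1) (by simpa [Int.even_add_one] using hi), Submodule.mem_bot] at this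
    · have : (a : R) = 0 := (Submodule.mem_bot k).1 ((hodd i hi).le a.2)
      simp [this]

end DGPoissonAlgebra

end SignTrivial

section LaurentGrading

variable (k B : Type) [Field k] [Ring B] [Algebra k B]

/-- The grading of `B[ℤ]` by exponent. -/
def laurentGrade (i : ℤ) : Submodule k (AddMonoidAlgebra B ℤ) :=
  LinearMap.range (AddMonoidAlgebra.lsingle (R := k) (S := B) i)

variable {k B}

lemma single_mem_laurentGrade (i : ℤ) (b : B) :
    AddMonoidAlgebra.single i b ∈ laurentGrade k B i := ⟨b, rfl⟩

instance laurentGrade.gradedMonoid : SetLike.GradedMonoid (laurentGrade k B) where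
  one_mem := ⟨1, rfl⟩
  mul_mem := by
    rintro i j _ _ ⟨a, rfl⟩ ⟨b, rfl⟩
    exact ⟨a * b, (AddMonoidAlgebra.single_mul_single ..).symm⟩

/-- The decomposition of `B[ℤ]` into its homogeneous components. -/
def laurentDecompose : AddMonoidAlgebra B ℤ →ₗ[k] ⨁ i, laurentGrade k B i :=
  (Finsupp.lsum k fun i => (DirectSum.lof k ℤ (fun i => laurentGrade k B i) i) ∘ₗ
    (AddMonoidAlgebra.lsingle (R := k) (S := B) i).rangeRestrict) ∘ₗ
    (AddMonoidAlgebra.coeffLinearEquiv k).toLinearMap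

lemma laurentDecompose_single (i : ℤ) (b : B) :
    laurentDecompose (k := k) (AddMonoidAlgebra.single i b) =
      DirectSum.lof k ℤ (fun i => laurentGrade k B i) i ⟨_, single_mem_laurentGrade i b⟩ := by
  simp [-LaurentPolynomial.single_eq_C_mul_T, laurentDecompose]
  rfl

instance laurentGrade.gradedAlgebra : GradedAlgebra (laurentGrade k B) where
  toDecomposition := .ofLinearMap _ laurentDecompose
    (by
      refine AddMonoidAlgebra.lhom_ext' fun i => LinearMap.ext fun b => ?_
      simp [-LaurentPolynomial.single_eq_C_mul_T, laurentDecompose_single])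
    (by
      refine DirectSum.linearMap_ext _ fun i => LinearMap.ext ?_
      rintro ⟨_, b, rfl⟩
      simp [-LaurentPolynomial.single_eq_C_mul_T, laurentDecompose_single])

/-- The extension of `δ : B → B` to a map of degree one on `B[ℤ]`. -/
def laurentShift (δ : B →ₗ[k] B) : AddMonoidAlgebra B ℤ →ₗ[k] AddMonoidAlgebra B ℤ :=
  (Finsupp.lsum k fun i => AddMonoidAlgebra.lsingle (R := k) (S := B) (i + 1) ∘ₗ δ) ∘ₗ
    (AddMonoidAlgebra.coeffLinearEquiv k).toLinearMap

@[simp]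
lemma laurentShift_single (δ : B →ₗ[k] B) (i : ℤ) (b : B) :
    laurentShift δ (AddMonoidAlgebra.single i b) = AddMonoidAlgebra.single (i + 1) (δ b) := by
  simp [-LaurentPolynomial.single_eq_C_mul_T, laurentShift]

/-- The DG algebra structure on `B[ℤ]` induced by a square-zero derivation of `B`. -/
def laurentDGAlgebra (δ : B →ₗ[k] B) (hsq : ∀ b, δ (δ b) = 0)
    (hmul : ∀ a b, δ (a * b) = δ a * b + a * δ b) (hδ : (∀ m, (sgn m : k) = 1) ∨ δ = 0) :
    DGAlgebra k (AddMonoidAlgebra B ℤ) (laurentGrade k B) where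
  d := laurentShift δ
  d_mem := by
    rintro i _ ⟨b, rfl⟩
    simpa [-LaurentPolynomial.single_eq_C_mul_T] using single_mem_laurentGrade (i + 1) (δ b)
  d_sq b := by
    induction b using AddMonoidAlgebra.induction_linear with
    | zero => simp
    | add a b ha hb => simp [ha, hb]
    | single i b => simp [-LaurentPolynomial.single_eq_C_mul_T, hsq]
  d_mul := by
    rintro i j _ _ ⟨a, rfl⟩ ⟨b, rfl⟩
    have : sgn i • (AddMonoidAlgebra.single i a * laurentShift δ (AddMonoidAlgebra.single j b)) =
        AddMonoidAlgebra.single i a * laurentShift δ (AddMonoidAlgebra.single j b) := by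
      rcases hδ with h | rfl
      · exact sgn_smul_of_cast_eq_one (h i) _
      · simp [-LaurentPolynomial.single_eq_C_mul_T]
    simp only [AddMonoidAlgebra.lsingle_apply]
    rw [this]
    simp [-LaurentPolynomial.single_eq_C_mul_T, AddMonoidAlgebra.single_mul_single, hmul,
      AddMonoidAlgebra.single_add, add_assoc, add_comm, add_left_comm]

/-- Setting the variable of `B[ℤ]` to `1`. -/
def laurentEval : AddMonoidAlgebra B ℤ →ₐ[k] B :=
  AddMonoidAlgebra.liftNCAlgHom (AlgHom.id k B) (1 : Multiplicative ℤ →* B)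
    fun _ _ => Commute.one_right _

@[simp]
lemma laurentEval_single (i : ℤ) (b : B) :
    laurentEval (k := k) (AddMonoidAlgebra.single i b) = b := by
  simp [-LaurentPolynomial.single_eq_C_mul_T, laurentEval]

end LaurentGrading

section Coaction

variable {k R B : Type} [Field k] [Ring R] [Algebra k R] [Ring B] [Algebra k B]
  (𝒜 : ℤ → Submodule k R) [GradedAlgebra 𝒜]

/-- The graded map `R → B[ℤ]` sending `a` of degree `i` to `G a` in degree `i`. -/
def gradedLift (G : R →ₗ[k] B) : R →ₗ[k] AddMonoidAlgebra B ℤ :=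
  (DirectSum.toModule k ℤ _ fun i =>
    AddMonoidAlgebra.lsingle (R := k) (S := B) i ∘ₗ G ∘ₗ (𝒜 i).subtype) ∘ₗ
    (DirectSum.decomposeLinearEquiv 𝒜).toLinearMap

variable {𝒜}

lemma gradedLift_of_mem (G : R →ₗ[k] B) {i : ℤ} {a : R} (ha : a ∈ 𝒜 i) :
    gradedLift 𝒜 G a = AddMonoidAlgebra.single i (G a) := by
  lift a to 𝒜 i using ha
  simp [-LaurentPolynomial.single_eq_C_mul_T, gradedLift]

variable (𝒜) in
/-- The map `gradedLift` of an algebra map, as an algebra map. -/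
def gradedLiftAlgHom (F : R →ₐ[k] B) : R →ₐ[k] AddMonoidAlgebra B ℤ :=
  AlgHom.ofLinearMap (gradedLift 𝒜 F.toLinearMap)
    (by
      rw [gradedLift_of_mem _ (SetLike.GradedOne.one_mem (A := 𝒜))]
      simp [-LaurentPolynomial.single_eq_C_mul_T, AddMonoidAlgebra.one_def])
    (fun a b => by
      induction a using DirectSum.Decomposition.inductionOn 𝒜 with
      | zero => simp
      | add a a' iha iha' => simp only [map_add, iha, iha', add_mul]
      | homogeneous a =>
        induction b using DirectSum.Decomposition.inductionOn 𝒜 with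
        | zero => simp
        | add b b' ihb ihb' => simp only [map_add, ihb, ihb', mul_add]
        | homogeneous b =>
          rw [gradedLift_of_mem _ a.2, gradedLift_of_mem _ b.2,
            gradedLift_of_mem _ (SetLike.GradedMul.mul_mem a.2 b.2)]
          simp [-LaurentPolynomial.single_eq_C_mul_T, AddMonoidAlgebra.single_mul_single])

lemma gradedLiftAlgHom_of_mem (F : R →ₐ[k] B) {i : ℤ} {a : R} (ha : a ∈ 𝒜 i) :
    gradedLiftAlgHom 𝒜 F a = AddMonoidAlgebra.single i (F a) :=
  gradedLift_of_mem _ ha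

lemma laurentEval_gradedLift (G : R →ₗ[k] B) (a : R) :
    laurentEval (k := k) (gradedLift 𝒜 G a) = G a := by
  induction a using DirectSum.Decomposition.inductionOn 𝒜 with
  | zero => simp
  | add a a' iha iha' => simp only [map_add, iha, iha']
  | homogeneous a => rw [gradedLift_of_mem _ a.2, laurentEval_single]

lemma gradedLift_d (P : DGPoissonAlgebra k R 𝒜) (G : R →ₗ[k] B) (δ : B →ₗ[k] B)
    (hG : ∀ a, G (P.d a) = δ (G a)) (a : R) :
    gradedLift 𝒜 G (P.d a) = laurentShift δ (gradedLift 𝒜 G a) := by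
  induction a using DirectSum.Decomposition.inductionOn 𝒜 with
  | zero => simp
  | add a a' iha iha' => simp only [map_add, iha, iha']
  | homogeneous a =>
    rw [gradedLift_of_mem _ a.2, gradedLift_of_mem _ (P.d_mem a.2), laurentShift_single, hG]

/-- If signs are trivial, the universal property of the enveloping algebra yields maps to
ungraded algebras equipped with a square-zero derivation. -/
theorem IsUEA.exists_algHom {E : Type} [Ring E] [Algebra k E] {ℰ : ℤ → Submodule k E}
    {P : DGPoissonAlgebra k R 𝒜} {DE : DGAlgebra k E ℰ} {mR : R →ₐ[k] E} {hR : R →ₗ[k] E}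
    (hUEA : IsUEA k 𝒜 ℰ P DE mR hR) (hs : SignTrivial 𝒜)
    (F : R →ₐ[k] B) (G : R →ₗ[k] B) (δ : B →ₗ[k] B) (hsq : ∀ b, δ (δ b) = 0)
    (hmul : ∀ a b, δ (a * b) = δ a * b + a * δ b) (hδ : (∀ m, (sgn m : k) = 1) ∨ δ = 0)
    (hFd : ∀ a, F (P.d a) = δ (F a)) (hGd : ∀ a, G (P.d a) = δ (G a))
    (hGG : ∀ a b, G (P.br a b) = G a * G b - G b * G a)
    (hFG : ∀ a b, F (P.br a b) = G a * F b - F b * G a)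
    (hGmul : ∀ a b, G (a * b) = F a * G b + F b * G a) :
    ∃ φ : E →ₐ[k] B, (∀ a, φ (mR a) = F a) ∧ ∀ a, φ (hR a) = G a := by
  obtain ⟨φ, ⟨-, hφm, hφh⟩, -⟩ := hUEA.2 (AddMonoidAlgebra B ℤ) (laurentGrade k B)
    (laurentDGAlgebra δ hsq hmul hδ) (gradedLiftAlgHom 𝒜 F) (gradedLift 𝒜 G) (by
      refine ⟨⟨fun i a ha => ?_, gradedLift_d P F.toLinearMap δ hFd⟩, fun i a ha => ?_,
        gradedLift_d P G δ hGd, fun i j a b ha hb => ?_, fun i j a b ha hb => ?_,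
        fun i j a b ha hb => ?_⟩
      · rw [gradedLiftAlgHom_of_mem F ha]
        exact single_mem_laurentGrade _ _
      · rw [gradedLift_of_mem G ha]
        exact single_mem_laurentGrade _ _
      · rw [hs.sgn_mul_smul ha _ fun h => by simp [h], gradedLift_of_mem G ha,
          gradedLift_of_mem G hb, gradedLift_of_mem G (P.br_mem ha hb), hGG]
        simp [-LaurentPolynomial.single_eq_C_mul_T, AddMonoidAlgebra.single_mul_single,
          add_comm j i, AddMonoidAlgebra.single_sub]
      · rw [hs.sgn_mul_smul ha _ fun h => by simp [h], gradedLift_of_mem G ha,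
          gradedLiftAlgHom_of_mem F hb, gradedLiftAlgHom_of_mem F (P.br_mem ha hb), hFG]
        simp [-LaurentPolynomial.single_eq_C_mul_T, AddMonoidAlgebra.single_mul_single,
          add_comm j i, AddMonoidAlgebra.single_sub]
      · rw [hs.sgn_mul_smul ha _ fun h => by simp [h], gradedLift_of_mem G ha,
          gradedLift_of_mem G hb, gradedLiftAlgHom_of_mem F ha, gradedLiftAlgHom_of_mem F hb,
          gradedLift_of_mem G (SetLike.GradedMul.mul_mem ha hb), hGmul]
        simp [-LaurentPolynomial.single_eq_C_mul_T, AddMonoidAlgebra.single_mul_single,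
          add_comm j i, AddMonoidAlgebra.single_add])
  refine ⟨laurentEval.comp φ, fun a => ?_, fun a => ?_⟩
  · have : φ (mR a) = gradedLiftAlgHom 𝒜 F a := DFunLike.congr_fun hφm a
    rw [AlgHom.comp_apply, this]
    exact laurentEval_gradedLift F.toLinearMap a
  · have : φ (hR a) = gradedLift 𝒜 G a := DFunLike.congr_fun hφh a
    rw [AlgHom.comp_apply, this, laurentEval_gradedLift]

end Coaction

section RightAction

variable {k R : Type} [Field k] [Ring R] [Algebra k R]

/-- The `k`-linear endomorphisms of `R` preserving `Q`. -/
def stabEnd (Q : Submodule k R) : Subalgebra k (Module.End k R) where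
  carrier := {T | ∀ q ∈ Q, T q ∈ Q}
  mul_mem' hS hT _ hq := hS _ (hT _ hq)
  add_mem' hS hT q hq := Q.add_mem (hS q hq) (hT q hq)
  algebraMap_mem' r _ hq := Q.smul_mem r hq

end RightAction

section OpCommutator

variable {k S : Type} [Field k] [Ring S] [Algebra k S]

variable (k) in
/-- The commutator derivation `T ↦ D T - T D` of an algebra, on the opposite algebra. -/
def opCommutator (D : S) : Sᵐᵒᵖ →ₗ[k] Sᵐᵒᵖ :=
  LinearMap.mulRight k (MulOpposite.op D) - LinearMap.mulLeft k (MulOpposite.op D)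

lemma opCommutator_apply (D : S) (T : Sᵐᵒᵖ) :
    opCommutator k D T = T * MulOpposite.op D - MulOpposite.op D * T := rfl

lemma opCommutator_zero : opCommutator k (0 : S) = 0 := by
  ext T : 1
  simp [opCommutator_apply]

lemma opCommutator_mul (D : S) (T U : Sᵐᵒᵖ) :
    opCommutator k D (T * U) = opCommutator k D T * U + T * opCommutator k D U := by
  simp only [opCommutator_apply]
  noncomm_ring

lemma opCommutator_opCommutator {D : S} (hD : D * D = 0)
    (h : (∀ m, (sgn m : k) = 1) ∨ opCommutator k D = 0) (T : Sᵐᵒᵖ) :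
    opCommutator k D (opCommutator k D T) = 0 := by
  rcases h with h | h
  · have hop : MulOpposite.op D * MulOpposite.op D = 0 := by
      rw [← MulOpposite.op_mul, hD, MulOpposite.op_zero]
    have hneg : ∀ U : Sᵐᵒᵖ, -U = U := fun U => by
      simpa [sgn] using sgn_smul_of_cast_eq_one (h 1) U
    simp only [opCommutator_apply, sub_mul, mul_sub, mul_assoc, hop, mul_zero]
    rw [← mul_assoc (MulOpposite.op D) (MulOpposite.op D), hop, zero_mul, zero_sub, sub_zero,
      hneg, sub_self]
  · simp [h]

end OpCommutator

section RightRegular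

variable {k R : Type} [Field k] [Ring R] [Algebra k R] {𝒜 : ℤ → Submodule k R}
  [GradedAlgebra 𝒜] (P : DGPoissonAlgebra k R 𝒜) (hs : SignTrivial 𝒜) {Q : Submodule k R}

/-- Multiplication by elements of `R`, acting on the right of `R`. -/
def mulOpStab (hQ : IsTwoSidedIdealSub k Q) : R →ₐ[k] (stabEnd Q)ᵐᵒᵖ :=
  AlgHom.ofLinearMap
    ((MulOpposite.opLinearEquiv k).toLinearMap ∘ₗ
      (LinearMap.mul k R).codRestrict (Subalgebra.toSubmodule (stabEnd Q))
        fun a q hq => (hQ a q hq).1)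
    (MulOpposite.unop_injective (Subtype.ext (LinearMap.ext fun r => one_mul r)))
    (fun a b => MulOpposite.unop_injective (Subtype.ext (LinearMap.ext fun r => by
      change a * b * r = b * (a * r)
      rw [P.mul_comm_of_signTrivial hs a b, mul_assoc])))

/-- The negated bracket with elements of `R`, acting on the right of `R`. -/
def negBrOpStab (hQ : IsDGPoissonIdeal k 𝒜 P Q) : R →ₗ[k] (stabEnd Q)ᵐᵒᵖ :=
  (MulOpposite.opLinearEquiv k).toLinearMap ∘ₗ
    (-P.br).codRestrict (Subalgebra.toSubmodule (stabEnd Q))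
      fun a q hq => Q.neg_mem (hQ.2 a q hq)

end RightRegular

/-- Assume `char k = 2` or every `|x_i|` is even, so that the
monomials form a `k`-basis of `R`.  If `M ≠ R` is a DG ideal of `R` and `Q ⊆ M` is a
DG Poisson ideal of `R`, then `R^e m_R(M) + R^e h_R(Q) R^e ≠ R^e`. -/
theorem stmt18 (k R E : Type) [Field k] [Ring R] [Algebra k R] [Ring E] [Algebra k E]
    (n : ℕ) (𝒜 : ℤ → Submodule k R) [GradedAlgebra 𝒜]
    (ℰ : ℤ → Submodule k E) [GradedAlgebra ℰ]
    (P : DGPoissonAlgebra k R 𝒜)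
    (x : Fin n → R) (w : Fin n → ℤ) (hx : ∀ i, x i ∈ 𝒜 (w i))
    (hgen : Algebra.adjoin k (Set.range x) = ⊤)
    (hchar : ringChar k = 2 ∨ ∀ i, Even (w i))
    (hbasis : LinearIndependent k (fun e : Fin n → ℕ => xMono x e) ∧
      Submodule.span k (Set.range fun e : Fin n → ℕ => xMono x e) = ⊤)
    (DE : DGAlgebra k E ℰ) (mR : R →ₐ[k] E) (hR : R →ₗ[k] E)
    (hUEA : IsUEA k 𝒜 ℰ P DE mR hR)
    (M : Submodule k R) (hM : IsDGIdeal k 𝒜 P.d M) (hMne : M ≠ ⊤)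
    (Q : Submodule k R) (hQ : IsDGPoissonIdeal k 𝒜 P Q) (hQM : Q ≤ M) :
    leftIdealGen k (⇑mR '' (M : Set R)) ⊔ idealGen k (⇑hR '' (Q : Set R))
      ≠ (⊤ : Submodule k E) := by
  have hs : SignTrivial 𝒜 := hchar.imp sgn_cast_of_ringChar_eq_two
    fun hw i hi => eq_bot_of_span_xMono hx hw hbasis.2 hi
  let D : stabEnd Q := ⟨P.d, hQ.1.2.2⟩
  have hDsq : D * D = 0 := Subtype.ext (LinearMap.ext P.d_sq)
  have hext : ∀ {S T : (stabEnd Q)ᵐᵒᵖ}, (∀ r, S.unop.1 r = T.unop.1 r) → S = T :=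
    fun h => MulOpposite.unop_injective (Subtype.ext (LinearMap.ext h))
  have hsign : (∀ m, (sgn m : k) = 1) ∨ opCommutator k D = 0 :=
    (P.sgn_cast_eq_one_or_d_eq_zero hs).imp_right fun h => by
      rw [show D = 0 from Subtype.ext h, opCommutator_zero]
  obtain ⟨φ, hφm, hφh⟩ := hUEA.exists_algHom hs (mulOpStab P hs hQ.1.1) (negBrOpStab P hQ)
    (opCommutator k D) (opCommutator_opCommutator hDsq hsign) (opCommutator_mul D) hsign
    (fun a => hext fun r => by
      change P.d a * r = P.d (a * r) - a * P.d r
      rw [P.d_mul_of_signTrivial hs, add_sub_cancel_right])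
    (fun a => hext fun r => by
      change -P.br (P.d a) r = P.d (-P.br a r) - -P.br a (P.d r)
      rw [map_neg, P.d_br_of_signTrivial hs]
      abel)
    (fun a b => hext fun r => by
      change -P.br (P.br a b) r = -P.br b (-P.br a r) - -P.br a (-P.br b r)
      rw [map_neg, map_neg, P.jacobi_of_signTrivial hs a b r]
      abel)
    (fun a b => hext fun r => by
      change P.br a b * r = b * -P.br a r - -P.br a (b * r)
      rw [P.br_mul_of_signTrivial hs, mul_neg]
      abel)
    (fun a b => hext fun r => by
      change -P.br (a * b) r = -P.br b (a * r) + -P.br a (b * r)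
      rw [← P.br_antisymm_of_signTrivial hs r, P.br_mul_of_signTrivial hs,
        P.br_mul_of_signTrivial hs, P.br_mul_of_signTrivial hs,
        P.br_antisymm_of_signTrivial hs r a, P.br_antisymm_of_signTrivial hs r b,
        P.br_antisymm_of_signTrivial hs b a, P.mul_comm_of_signTrivial hs _ b]
      noncomm_ring)
  have hMmem : ∀ z ∈ leftIdealGen k (⇑mR '' (M : Set R)) ⊔ idealGen k (⇑hR '' (Q : Set R)),
      (φ z).unop.1 1 ∈ M := by
    let ev : E →ₗ[k] R := LinearMap.applyₗ (1 : R) ∘ₗ (stabEnd Q).val.toLinearMap ∘ₗ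
      (MulOpposite.opLinearEquiv k).symm.toLinearMap ∘ₗ φ.toLinearMap
    change _ ≤ M.comap ev
    refine sup_le (Submodule.span_le.2 ?_) (Submodule.span_le.2 ?_)
    · rintro _ ⟨u, _, ⟨a, ha, rfl⟩, rfl⟩
      change (φ (u * mR a)).unop.1 1 ∈ M
      rw [map_mul, hφm]
      exact (hM.1 _ a ha).2
    · rintro _ ⟨u, v, _, ⟨q, hq, rfl⟩, rfl⟩
      change (φ (u * hR q * v)).unop.1 1 ∈ M
      rw [map_mul, map_mul, hφh]
      refine hQM ((φ v).unop.2 _ ?_)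
      change -P.br q ((φ u).unop.1 1) ∈ Q
      rw [← P.br_antisymm_of_signTrivial hs]
      exact hQ.2 _ q hq
  intro htop
  have hone : (φ 1).unop.1 1 ∈ M := hMmem 1 (htop ▸ Submodule.mem_top)
  rw [map_one φ] at hone
  change (1 : R) ∈ M at hone
  exact hMne ((Submodule.eq_top_iff').2 fun r => by simpa using (hM.1 r 1 hone).1)
end
end
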